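/- arXiv:2001.01519 — 7 statements merged into one kernel-verified Lean document; each statement's English description precedes it below -/
import Mathlib

section
/- Let ψ : ℝ → ℝ be continuous on [0,∞) and twice differentiable on (0,∞), and suppose there are constants 0 < c ≤ C such that c ≤ −θ·ψ''(θ) ≤ C for all θ > 0. Then the internal energy e(θ) := ψ(θ) − θ·ψ'(θ) satisfies ψ(0) + c·θ ≤ e(θ) ≤ ψ(0) + C·θ for every θ > 0. -/
open Set

/-- The tangent line at `θ > 0` of a function with nonnegative second derivative on `(0,∞)`
lies below the function at `0`. -/
theorem sub_mul_deriv_le_of_deriv2_nonneg {f f' f'' : ℝ → ℝ}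
    (hcont : ContinuousOn f (Ici 0))
    (hf : ∀ x, 0 < x → HasDerivAt f (f' x) x)
    (hf' : ∀ x, 0 < x → HasDerivAt f' (f'' x) x)
    (hnonneg : ∀ x, 0 < x → 0 ≤ f'' x) {θ : ℝ} (hθ : 0 < θ) :
    f θ - θ * f' θ ≤ f 0 := by
  obtain ⟨ξ, ⟨hξ, hξθ⟩, hslope⟩ := exists_hasDerivAt_eq_slope f f' hθ
    (hcont.mono Icc_subset_Ici_self) fun x hx => hf x hx.1
  have hmono : MonotoneOn f' (Ioi 0) := by
    apply monotoneOn_of_hasDerivWithinAt_nonneg (f' := f'') (convex_Ioi 0)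
      fun x hx => (hf' x hx).continuousAt.continuousWithinAt
    · intro x hx
      rw [interior_Ioi] at hx
      exact (hf' x hx).hasDerivWithinAt
    · intro x hx
      rw [interior_Ioi] at hx
      exact hnonneg x hx
  have hle : f' ξ ≤ f' θ := hmono hξ hθ hξθ.le
  rw [hslope, sub_zero, div_le_iff₀ hθ] at hle
  linarith

/-- An upper bound on `-x * f'' x` bounds the growth of `f x - x * f' x`: the function
`f x + K * (x * log x)` is convex. -/
theorem sub_mul_deriv_le_add_mul {f f' f'' : ℝ → ℝ} {K : ℝ}
    (hcont : ContinuousOn f (Ici 0))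
    (hf : ∀ x, 0 < x → HasDerivAt f (f' x) x)
    (hf' : ∀ x, 0 < x → HasDerivAt f' (f'' x) x)
    (hK : ∀ x, 0 < x → -x * f'' x ≤ K) {θ : ℝ} (hθ : 0 < θ) :
    f θ - θ * f' θ ≤ f 0 + K * θ := by
  have h := sub_mul_deriv_le_of_deriv2_nonneg
    (f := fun x => f x + K * (x * Real.log x)) (f' := fun x => f' x + K * (Real.log x + 1))
    (f'' := fun x => f'' x + K * x⁻¹)
    (hcont.add (Real.continuous_mul_log.const_mul K).continuousOn)
    (fun x hx => (hf x hx).add ((Real.hasDerivAt_mul_log hx.ne').const_mul K))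
    (fun x hx => (hf' x hx).add (((Real.hasDerivAt_log hx.ne').add_const 1).const_mul K))
    (fun x hx => by
      have hdiv : -f'' x ≤ K / x := by
        rw [le_div_iff₀ hx]
        linarith [hK x hx]
      rw [div_eq_mul_inv] at hdiv
      linarith) hθ
  simp only [zero_mul, mul_zero, add_zero] at h
  linarith

/-- Lemma 1.8 (growth of the internal energy): if the heat capacity
`-θ·ψ''(θ)` is bounded between positive constants `c ≤ C` on `(0,∞)`,
then the internal energy `e(θ) = ψ(θ) - θ·ψ'(θ)` satisfies
`ψ(0) + c·θ ≤ e(θ) ≤ ψ(0) + C·θ` for all `θ > 0`. -/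
theorem internal_energy_growth
    (ψ : ℝ → ℝ) (c C : ℝ)
    (hcont : ContinuousOn ψ (Set.Ici (0 : ℝ)))
    (hdiff : ∀ θ ∈ Set.Ioi (0 : ℝ), DifferentiableAt ℝ ψ θ)
    (hdiff2 : ∀ θ ∈ Set.Ioi (0 : ℝ), DifferentiableAt ℝ (deriv ψ) θ)
    (hc : 0 < c) (hcC : c ≤ C)
    (hheat : ∀ θ : ℝ, 0 < θ →
      c ≤ -θ * deriv (deriv ψ) θ ∧ -θ * deriv (deriv ψ) θ ≤ C) :
    ∀ θ : ℝ, 0 < θ →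
      ψ 0 + c * θ ≤ ψ θ - θ * deriv ψ θ ∧
      ψ θ - θ * deriv ψ θ ≤ ψ 0 + C * θ := by
  intro θ hθ
  have hψ : ∀ x, 0 < x → HasDerivAt ψ (deriv ψ x) x := fun x hx => (hdiff x hx).hasDerivAt
  have hψ' : ∀ x, 0 < x → HasDerivAt (deriv ψ) (deriv (deriv ψ) x) x :=
    fun x hx => (hdiff2 x hx).hasDerivAt
  constructor
  · have h := sub_mul_deriv_le_add_mul (K := -c) hcont.neg (fun x hx => (hψ x hx).neg)
      (fun x hx => (hψ' x hx).neg) (fun x hx => by linarith [(hheat x hx).1]) hθ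
    simp only [Pi.neg_apply] at h
    linarith
  · exact sub_mul_deriv_le_add_mul hcont hψ hψ' (fun x hx => (hheat x hx).2) hθ
end

section
/- For all real numbers x, y > 0: x − y − y·(log x − log y) ≥ (1/4)·√y·(√x − √y)·(log x − log y). -/
/-- Formula (3.3) in the proof of Lemma 3.7: for all `x, y > 0`,
`x - y - y·(log x - log y) ≥ (1/4)·√y·(√x - √y)·(log x - log y)`. -/
theorem relative_distance_lower_bound (x y : ℝ) (hx : 0 < x) (hy : 0 < y) :
    x - y - y * (Real.log x - Real.log y) ≥
      (1 / 4) * Real.sqrt y * (Real.sqrt x - Real.sqrt y) *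
        (Real.log x - Real.log y) := by
  obtain ⟨a, ha, rfl⟩ : ∃ a : ℝ, 0 < a ∧ a ^ 2 = x :=
    ⟨√x, Real.sqrt_pos.2 hx, Real.sq_sqrt hx.le⟩
  obtain ⟨b, hb, rfl⟩ : ∃ b : ℝ, 0 < b ∧ b ^ 2 = y :=
    ⟨√y, Real.sqrt_pos.2 hy, Real.sq_sqrt hy.le⟩
  rw [Real.sqrt_sq ha.le, Real.sqrt_sq hb.le, Real.log_pow, Real.log_pow]
  push_cast
  have hlog : b * (Real.log a - Real.log b) ≤ a - b := by
    rw [← Real.log_div ha.ne' hb.ne']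
    calc b * Real.log (a / b) ≤ b * (a / b - 1) := by
          gcongr
          exact Real.log_le_sub_one_of_pos (div_pos ha hb)
      _ = a - b := by field_simp
  have hmul := mul_le_mul_of_nonneg_left hlog (by positivity : 0 ≤ a + 3 * b)
  linarith [sq_nonneg (a - b)]
end

section
/- Let f : (0,∞) → ℝ be differentiable with |f'(x)|·(x + 1) ≤ c for all x > 0, for some constant c > 0. Then for all x, y > 0: |f(x) − f(y)|² ≤ c²·(√x − √y)·(log x − log y); in particular the right-hand side is nonnegative. -/
/-- On a convex set, a function whose derivative is dominated in absolute value by the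
derivative of `g` has increments dominated by those of `g`. -/
theorem abs_sub_le_sub_of_abs_deriv_le {D : Set ℝ} (hD : Convex ℝ D)
    {f g f' g' : ℝ → ℝ} (hf : ∀ x ∈ D, HasDerivAt f (f' x) x)
    (hg : ∀ x ∈ D, HasDerivAt g (g' x) x) (hfg : ∀ x ∈ D, |f' x| ≤ g' x)
    {x y : ℝ} (hx : x ∈ D) (hy : y ∈ D) (hxy : x ≤ y) :
    |f y - f x| ≤ g y - g x := by
  have hsub : MonotoneOn (g - f) D :=
    monotoneOn_of_hasDerivWithinAt_nonneg hD
      (fun z hz => ((hg z hz).sub (hf z hz)).continuousAt.continuousWithinAt)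
      (fun z hz => ((hg z (interior_subset hz)).sub (hf z (interior_subset hz))).hasDerivWithinAt)
      (fun z hz => sub_nonneg.2 (abs_le.1 (hfg z (interior_subset hz))).2)
  have hadd : MonotoneOn (g + f) D :=
    monotoneOn_of_hasDerivWithinAt_nonneg hD
      (fun z hz => ((hg z hz).add (hf z hz)).continuousAt.continuousWithinAt)
      (fun z hz => ((hg z (interior_subset hz)).add (hf z (interior_subset hz))).hasDerivWithinAt)
      (fun z hz => by linarith [(abs_le.1 (hfg z (interior_subset hz))).1])
  have h₁ := hsub hx hy hxy
  have h₂ := hadd hx hy hxy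
  simp only [Pi.sub_apply, Pi.add_apply] at h₁ h₂
  exact abs_le.2 ⟨by linarith, by linarith⟩

/-- Combined estimate from the proof of Lemma 3.7: if `|f'(x)|·(x + 1) ≤ c`
on `(0,∞)`, then `|f(x) - f(y)|² ≤ c²·(√x - √y)·(log x - log y)` for all
`x, y > 0`; in particular the right-hand side is nonnegative. -/
theorem sq_diff_le_sqrt_mul_log
    (f : ℝ → ℝ) (c : ℝ) (hc : 0 < c)
    (hdiff : ∀ x ∈ Set.Ioi (0 : ℝ), DifferentiableAt ℝ f x)
    (hderiv : ∀ x : ℝ, 0 < x → |deriv f x| * (x + 1) ≤ c) :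
    ∀ x y : ℝ, 0 < x → 0 < y →
      |f x - f y| ^ 2 ≤
        c ^ 2 * ((Real.sqrt x - Real.sqrt y) * (Real.log x - Real.log y)) ∧
      0 ≤ (Real.sqrt x - Real.sqrt y) * (Real.log x - Real.log y) := by
  have hf : ∀ x ∈ Set.Ioi (0 : ℝ), HasDerivAt f (deriv f x) x :=
    fun x hx => (hdiff x hx).hasDerivAt
  have hsqrt : ∀ x y : ℝ, 0 < x → 0 < y → x ≤ y →
      |f y - f x| ≤ c * Real.sqrt y - c * Real.sqrt x := by
    intro x y hx hy hxy
    refine abs_sub_le_sub_of_abs_deriv_le (g := fun t => c * Real.sqrt t)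
      (convex_Ioi 0) hf
      (fun t ht => (Real.hasDerivAt_sqrt (ne_of_gt ht)).const_mul c) ?_ hx hy hxy
    intro t ht
    have ht' : 0 < t := ht
    have hs : 0 < Real.sqrt t := Real.sqrt_pos.2 ht'
    rw [mul_one_div, le_div_iff₀ (by positivity)]
    refine le_trans (mul_le_mul_of_nonneg_left ?_ (abs_nonneg _)) (hderiv t ht)
    nlinarith [sq_nonneg (Real.sqrt t - 1), Real.sq_sqrt ht'.le]
  have hlog : ∀ x y : ℝ, 0 < x → 0 < y → x ≤ y →
      |f y - f x| ≤ c * Real.log y - c * Real.log x := by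
    intro x y hx hy hxy
    refine abs_sub_le_sub_of_abs_deriv_le (g := fun t => c * Real.log t)
      (convex_Ioi 0) hf
      (fun t ht => (Real.hasDerivAt_log (ne_of_gt ht)).const_mul c) ?_ hx hy hxy
    intro t ht
    rw [← div_eq_mul_inv, le_div_iff₀ ht]
    exact le_trans (mul_le_mul_of_nonneg_left (by linarith) (abs_nonneg _)) (hderiv t ht)
  intro x y hx hy
  wlog hxy : x ≤ y generalizing x y
  · obtain ⟨h₁, h₂⟩ := this y x hy hx (le_of_not_ge hxy)
    rw [abs_sub_comm, ← neg_sub (Real.sqrt y), ← neg_sub (Real.log y), neg_mul_neg]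
    exact ⟨h₁, h₂⟩
  refine ⟨?_, mul_nonneg_of_nonpos_of_nonpos (sub_nonpos.2 (Real.sqrt_le_sqrt hxy))
    (sub_nonpos.2 (Real.log_le_log hx hxy))⟩
  have hs := hsqrt x y hx hy hxy
  calc |f x - f y| ^ 2 = |f y - f x| * |f y - f x| := by rw [abs_sub_comm, sq]
    _ ≤ (c * Real.sqrt y - c * Real.sqrt x) * (c * Real.log y - c * Real.log x) :=
      mul_le_mul hs (hlog x y hx hy hxy) (abs_nonneg _) ((abs_nonneg _).trans hs)
    _ = c ^ 2 * ((Real.sqrt x - Real.sqrt y) * (Real.log x - Real.log y)) := by ring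
end

section
/- Let R > 0, Θ > 0, C > 0, and let f : ℝ → ℝ be differentiable with |f'(x)| ≤ C for all x ∈ [−R, R]. Then there exists a constant C' > 0, depending only on R, C, and Θ, such that (f(z) − f(z̃))·(θ − θ̃) ≤ C'·((z − z̃)² + θ − θ̃ − θ̃·(log θ − log θ̃)) for all θ > 0, all θ̃ ∈ (0, Θ], and all z, z̃ ∈ [−R, R]. One may take C' = max(4RC, CΘ/(4R)). -/
/-- The convex conjugate `-log (1 - p) - p` of `x - log (1 + x)` is at most `p ^ 2` on
`[-1/2, 1/2]`. -/
theorem neg_log_one_sub_sub_le_sq {p : ℝ} (hp : |p| ≤ 1 / 2) :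
    -Real.log (1 - p) - p ≤ p ^ 2 := by
  obtain ⟨hp₁, hp₂⟩ := abs_le.mp hp
  have h_pos : 0 < 1 - p := by linarith
  have key : 1 ≤ (1 - p) * Real.exp (p + p ^ 2) := by
    rcases le_total 0 p with h | h
    · have h_exp := Real.quadratic_le_exp_of_nonneg (show 0 ≤ p + p ^ 2 by positivity)
      have h_cubic : 0 ≤ 1 - p - p ^ 2 - p ^ 3 := by nlinarith [mul_nonneg h h]
      have h_prod := mul_nonneg (sq_nonneg p) h_cubic
      nlinarith [mul_le_mul_of_nonneg_left h_exp h_pos.le]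
    · have h_exp := Real.add_one_le_exp (p + p ^ 2)
      nlinarith [mul_le_mul_of_nonneg_left h_exp h_pos.le,
        mul_nonneg (neg_nonneg.mpr h) (sq_nonneg p)]
  have h_log := Real.log_nonneg key
  rw [Real.log_mul h_pos.ne' (Real.exp_pos _).ne', Real.log_exp] at h_log
  linarith

/-- The Fenchel–Young inequality for `x - log (1 + x)`, rescaled by `b` with `x = (a - b) / b`. -/
theorem mul_sub_le_relative_distance_add_conjugate {a b p : ℝ} (ha : 0 < a) (hb : 0 < b)
    (hp : p < 1) :
    p * (a - b) ≤ a - b - b * (Real.log a - Real.log b) + b * (-Real.log (1 - p) - p) := by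
  have h_pos : 0 < 1 - p := by linarith
  have h := Real.log_le_sub_one_of_pos (mul_pos (div_pos ha hb) h_pos)
  rw [Real.log_mul (div_pos ha hb).ne' h_pos.ne', Real.log_div ha.ne' hb.ne'] at h
  have h' := mul_le_mul_of_nonneg_left h hb.le
  have h_cancel : b * (a / b * (1 - p) - 1) = a * (1 - p) - b := by field_simp
  rw [h_cancel] at h'
  linarith


/-- Lemma 3.8: if `f : ℝ → ℝ` is differentiable with `|f'| ≤ C` on
`[-R, R]`, then with `C' = max (4RC) (CΘ/(4R))` one has
`(f(z) - f(z̃))·(θ - θ̃) ≤ C'·((z - z̃)² + θ - θ̃ - θ̃·(log θ - log θ̃))`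
for all `θ > 0`, `θ̃ ∈ (0, Θ]`, and `z, z̃ ∈ [-R, R]`. -/
theorem fenchel_young_cross_term_estimate
    (R Θ C : ℝ) (hR : 0 < R) (hΘ : 0 < Θ) (hC : 0 < C)
    (f : ℝ → ℝ) (hf : Differentiable ℝ f)
    (hf' : ∀ x ∈ Set.Icc (-R) R, |deriv f x| ≤ C) :
    ∃ C' : ℝ, 0 < C' ∧ C' = max (4 * R * C) (C * Θ / (4 * R)) ∧
      ∀ θ θt z zt : ℝ, 0 < θ → 0 < θt → θt ≤ Θ →
        z ∈ Set.Icc (-R) R → zt ∈ Set.Icc (-R) R →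
        (f z - f zt) * (θ - θt) ≤
          C' * ((z - zt) ^ 2 + θ - θt - θt * (Real.log θ - Real.log θt)) := by
  refine ⟨_, lt_max_of_lt_left (by positivity), rfl, ?_⟩
  intro θ θt z zt hθ hθt hθtΘ hz hzt
  set d := θ - θt - θt * (Real.log θ - Real.log θt) with hd
  have hd_nonneg : 0 ≤ d := by
    simpa [hd] using mul_sub_le_relative_distance_add_conjugate hθ hθt zero_lt_one
  have h_lip : |f z - f zt| ≤ C * |z - zt| := by
    simpa only [Real.norm_eq_abs] using
      (convex_Icc (-R) R).norm_image_sub_le_of_norm_deriv_le (fun x _ => hf x) hf' hzt hz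
  have h_diam : |z - zt| ≤ 2 * R :=
    abs_le.mpr ⟨by linarith [hz.1, hzt.2], by linarith [hz.2, hzt.1]⟩
  set p := (f z - f zt) / (4 * R * C) with hp_def
  have hRC : 0 < 4 * R * C := by positivity
  have hp : |p| ≤ |z - zt| / (4 * R) := by
    rw [hp_def, abs_div, abs_of_pos hRC, div_le_div_iff₀ hRC (by positivity)]
    nlinarith [mul_le_mul_of_nonneg_left h_lip hR.le]
  have hp_half : |p| ≤ 1 / 2 :=
    hp.trans ((div_le_iff₀ (by positivity)).mpr (by linarith))
  have hp_sq : p ^ 2 ≤ (z - zt) ^ 2 / (4 * R) ^ 2 := by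
    rw [← sq_abs p, ← sq_abs (z - zt), ← div_pow]
    gcongr
  have h_young : p * (θ - θt) ≤ d + Θ * ((z - zt) ^ 2 / (4 * R) ^ 2) := by
    have h := mul_sub_le_relative_distance_add_conjugate hθ hθt
      (show p < 1 by linarith [le_abs_self p])
    have h_conj := mul_le_mul_of_nonneg_left
      ((neg_log_one_sub_sub_le_sq hp_half).trans hp_sq) hθt.le
    have h_bound : θt * ((z - zt) ^ 2 / (4 * R) ^ 2) ≤ Θ * ((z - zt) ^ 2 / (4 * R) ^ 2) := by
      gcongr
    linarith
  calc (f z - f zt) * (θ - θt) = 4 * R * C * (p * (θ - θt)) := by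
        rw [hp_def]; field_simp
    _ ≤ 4 * R * C * (d + Θ * ((z - zt) ^ 2 / (4 * R) ^ 2)) := by gcongr
    _ = C * Θ / (4 * R) * (z - zt) ^ 2 + 4 * R * C * d := by field_simp; ring
    _ ≤ max (4 * R * C) (C * Θ / (4 * R)) * (z - zt) ^ 2
          + max (4 * R * C) (C * Θ / (4 * R)) * d := by
        gcongr
        · exact le_max_right _ _
        · exact le_max_left _ _
    _ = _ := by rw [hd]; ring
end

section
/- Let ψ : (0,∞) → ℝ be twice differentiable and suppose there is a constant c > 0 with −r·ψ''(r) ≥ c for all r > 0. Then for all θ, θ̃ > 0: ψ(θ) − ψ(θ̃) + ψ'(θ)·(θ̃ − θ) ≥ c·(θ − θ̃ − θ̃·(log θ − log θ̃)). -/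
/-- A function which is concave on a set lies below its tangent lines. -/
lemma ConcaveOn.le_add_mul_sub_of_hasDerivAt {S : Set ℝ} {f : ℝ → ℝ} {x y f' : ℝ}
    (hf : ConcaveOn ℝ S f) (hx : x ∈ S) (hy : y ∈ S) (hd : HasDerivAt f f' x) :
    f y ≤ f x + f' * (y - x) := by
  rcases lt_trichotomy x y with h | rfl | h
  · have := hf.slope_le_of_hasDerivAt hx hy h hd
    rw [slope_def_field, div_le_iff₀ (sub_pos.2 h)] at this
    linarith
  · simp
  · have := hf.le_slope_of_hasDerivAt hy hx h hd
    rw [slope_def_field, le_div_iff₀ (sub_pos.2 h)] at this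
    linarith

/-- Temperature part of Proposition 3.2: if the heat capacity
`-r·ψ''(r)` is bounded below by `c > 0` on `(0,∞)`, then the negative
first-order Taylor gap of `ψ` dominates the relative temperature
distance: `ψ(θ) - ψ(θ̃) + ψ'(θ)·(θ̃ - θ) ≥ c·(θ - θ̃ - θ̃·(log θ - log θ̃))`. -/
theorem relative_energy_temperature_coercivity
    (ψ : ℝ → ℝ) (c : ℝ) (hc : 0 < c)
    (hdiff : ∀ r ∈ Set.Ioi (0 : ℝ), DifferentiableAt ℝ ψ r)
    (hdiff2 : ∀ r ∈ Set.Ioi (0 : ℝ), DifferentiableAt ℝ (deriv ψ) r)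
    (hheat : ∀ r : ℝ, 0 < r → c ≤ -r * deriv (deriv ψ) r) :
    ∀ θ θt : ℝ, 0 < θ → 0 < θt →
      ψ θ - ψ θt + deriv ψ θ * (θt - θ) ≥
        c * (θ - θt - θt * (Real.log θ - Real.log θt)) := by
  intro θ θt hθ hθt
  have hderiv (r : ℝ) (hr : 0 < r) :
      HasDerivAt (fun s ↦ ψ s + c * (s * Real.log s - s)) (deriv ψ r + c * Real.log r) r := by
    refine ((hdiff r hr).hasDerivAt.add
      (((Real.hasDerivAt_mul_log hr.ne').sub (hasDerivAt_id r)).const_mul c)).congr_deriv ?_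
    ring
  have hderiv2 (r : ℝ) (hr : 0 < r) :
      HasDerivAt (fun s ↦ deriv ψ s + c * Real.log s) (deriv (deriv ψ) r + c * r⁻¹) r :=
    (hdiff2 r hr).hasDerivAt.add ((Real.hasDerivAt_log hr.ne').const_mul c)
  have hnonpos (r : ℝ) (hr : 0 < r) : deriv (deriv ψ) r + c * r⁻¹ ≤ 0 := by
    have h : c / r ≤ -deriv (deriv ψ) r := by
      rw [div_le_iff₀ hr]
      linarith [hheat r hr]
    rw [div_eq_mul_inv] at h
    linarith
  have hconc : ConcaveOn ℝ (Set.Ioi 0) (fun s ↦ ψ s + c * (s * Real.log s - s)) := by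
    refine concaveOn_of_hasDerivWithinAt2_nonpos (convex_Ioi 0)
      (fun r hr ↦ (hderiv r hr).continuousAt.continuousWithinAt)
      (f' := fun s ↦ deriv ψ s + c * Real.log s)
      (f'' := fun s ↦ deriv (deriv ψ) s + c * s⁻¹) ?_ ?_ ?_ <;> rw [interior_Ioi]
    · exact fun r hr ↦ (hderiv r hr).hasDerivWithinAt
    · exact fun r hr ↦ (hderiv2 r hr).hasDerivWithinAt
    · exact hnonpos
  have htangent := hconc.le_add_mul_sub_of_hasDerivAt hθ hθt (hderiv θ hθ)
  linarith
end

section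
/- Let μ̄ > 0 and let m, m₁, m₂ be real numbers with 0 < m ≤ μ̄ and m·m₂ + m₁² ≤ 0. Then for every real number y and all vectors B, D in a real inner product space (in the paper, ℝ³): (−m₂/(2m²) + m₁²/m³)·‖B‖²·y² − 2·(m₁/m²)·⟨B, D⟩·y + (1/m)·‖D‖² ≥ (1/(3μ̄))·‖D‖². -/
open RealInnerProductSpace

/-- Pointwise Hessian bound (formula (3.6)) from the proof of
Proposition 3.2: if `0 < m ≤ μ̄` and `m·m₂ + m₁² ≤ 0`, then for every
`y : ℝ` and all vectors `B, D`,
`(-m₂/(2m²) + m₁²/m³)·‖B‖²·y² - 2·(m₁/m²)·⟨B,D⟩·y + (1/m)·‖D‖²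
  ≥ (1/(3μ̄))·‖D‖²`. -/
theorem magnetic_hessian_bound
    {E : Type*} [NormedAddCommGroup E] [InnerProductSpace ℝ E]
    (μbar m m₁ m₂ : ℝ) (hμbar : 0 < μbar) (hm : 0 < m) (hmμ : m ≤ μbar)
    (hconc : m * m₂ + m₁ ^ 2 ≤ 0) :
    ∀ (y : ℝ) (B D : E),
      (-m₂ / (2 * m ^ 2) + m₁ ^ 2 / m ^ 3) * ‖B‖ ^ 2 * y ^ 2 -
          2 * (m₁ / m ^ 2) * ⟪B, D⟫ * y + (1 / m) * ‖D‖ ^ 2 ≥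
        (1 / (3 * μbar)) * ‖D‖ ^ 2 := by
  intro y B D
  have h_square : ‖(3 * m₁ * y) • B - (2 * m) • D‖ ^ 2 =
      9 * m₁ ^ 2 * y ^ 2 * ‖B‖ ^ 2 - 12 * m * m₁ * y * ⟪B, D⟫ + 4 * m ^ 2 * ‖D‖ ^ 2 := by
    rw [norm_sub_sq_real, norm_smul, norm_smul, real_inner_smul_left, real_inner_smul_right,
      mul_pow, mul_pow, Real.norm_eq_abs, Real.norm_eq_abs, sq_abs, sq_abs]
    ring
  have h_decomp : (-m₂ / (2 * m ^ 2) + m₁ ^ 2 / m ^ 3) * ‖B‖ ^ 2 * y ^ 2 -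
        2 * (m₁ / m ^ 2) * ⟪B, D⟫ * y + (1 / m) * ‖D‖ ^ 2 =
      -(m * m₂ + m₁ ^ 2) / (2 * m ^ 3) * (‖B‖ ^ 2 * y ^ 2) +
        ‖(3 * m₁ * y) • B - (2 * m) • D‖ ^ 2 / (6 * m ^ 3) + 1 / (3 * m) * ‖D‖ ^ 2 := by
    rw [h_square]
    field_simp
    ring
  have h_concave : 0 ≤ -(m * m₂ + m₁ ^ 2) / (2 * m ^ 3) * (‖B‖ ^ 2 * y ^ 2) :=
    mul_nonneg (div_nonneg (neg_nonneg.mpr hconc) (by positivity)) (by positivity)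
  have h_nonneg : 0 ≤ ‖(3 * m₁ * y) • B - (2 * m) • D‖ ^ 2 / (6 * m ^ 3) := by positivity
  have h_mono : 1 / (3 * μbar) * ‖D‖ ^ 2 ≤ 1 / (3 * m) * ‖D‖ ^ 2 := by gcongr
  rw [h_decomp]
  linarith
end

section
/- Let ψ : (0,∞) → ℝ be twice differentiable and suppose there are constants K, C > 0 such that the heat capacity E(r) := −r·ψ''(r) satisfies |E(r) − E(s)| ≤ K·|r − s| and E(r) ≤ C for all r, s > 0. Then for all θ, θ̃ > 0: θ̃·(ψ'(θ) − ψ'(θ̃) − ψ''(θ̃)·(θ − θ̃)) ≤ (K·θ̃ + C)·(θ − θ̃ − θ̃·(log θ − log θ̃)). -/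
/-- A function on `(0,∞)` whose derivative at `r` has the sign of `r - t` is minimal at `t`. -/
theorem le_of_hasDerivAt_of_sub_mul_nonneg {g g' : ℝ → ℝ} {t x : ℝ} (ht : 0 < t) (hx : 0 < x)
    (hg : ∀ r, 0 < r → HasDerivAt g (g' r) r) (hsign : ∀ r, 0 < r → 0 ≤ (r - t) * g' r) :
    g t ≤ g x := by
  rcases lt_trichotomy t x with h | rfl | h
  · obtain ⟨c, hc, hslope⟩ := exists_hasDerivAt_eq_slope g g' h
      (fun r hr => (hg r (ht.trans_le hr.1)).continuousAt.continuousWithinAt)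
      (fun r hr => hg r (ht.trans hr.1))
    have hc' : 0 ≤ g' c :=
      nonneg_of_mul_nonneg_right (hsign c (ht.trans hc.1)) (sub_pos.2 hc.1)
    rw [eq_div_iff (sub_pos.2 h).ne'] at hslope
    nlinarith [mul_nonneg hc' (sub_pos.2 h).le]
  · exact le_rfl
  · obtain ⟨c, hc, hslope⟩ := exists_hasDerivAt_eq_slope g g' h
      (fun r hr => (hg r (hx.trans_le hr.1)).continuousAt.continuousWithinAt)
      (fun r hr => hg r (hx.trans hr.1))
    have hc' : g' c ≤ 0 := by
      by_contra! hpos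
      exact (mul_neg_of_neg_of_pos (sub_neg.2 hc.2) hpos).not_ge (hsign c (hx.trans hc.1))
    rw [eq_div_iff (sub_pos.2 h).ne'] at hslope
    nlinarith [mul_nonneg (neg_nonneg.2 hc') (sub_pos.2 h).le]

/-- Key estimate of Section 3.4: if the heat capacity `E(r) = -r·ψ''(r)`
is `K`-Lipschitz and bounded above by `C` on `(0,∞)`, then for all
`θ, θ̃ > 0`,
`θ̃·(ψ'(θ) - ψ'(θ̃) - ψ''(θ̃)·(θ - θ̃))
  ≤ (K·θ̃ + C)·(θ - θ̃ - θ̃·(log θ - log θ̃))`. -/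
theorem entropy_difference_estimate
    (ψ : ℝ → ℝ) (K C : ℝ) (hK : 0 < K) (hC : 0 < C)
    (hdiff : ∀ r ∈ Set.Ioi (0 : ℝ), DifferentiableAt ℝ ψ r)
    (hdiff2 : ∀ r ∈ Set.Ioi (0 : ℝ), DifferentiableAt ℝ (deriv ψ) r)
    (hlip : ∀ r s : ℝ, 0 < r → 0 < s →
      |(-r * deriv (deriv ψ) r) - (-s * deriv (deriv ψ) s)| ≤ K * |r - s|)
    (hbound : ∀ r : ℝ, 0 < r → -r * deriv (deriv ψ) r ≤ C) :
    ∀ θ θt : ℝ, 0 < θ → 0 < θt →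
      θt * (deriv ψ θ - deriv ψ θt - deriv (deriv ψ) θt * (θ - θt)) ≤
        (K * θt + C) * (θ - θt - θt * (Real.log θ - Real.log θt)) := by
  intro θ t hθ ht
  set e := deriv (deriv ψ)
  have hderiv : ∀ r, 0 < r → HasDerivAt
      (fun r => (K * t + C) * (r - t - t * (Real.log r - Real.log t)) -
        t * (deriv ψ r - deriv ψ t - e t * (r - t)))
      ((K * t + C) * (1 - t * r⁻¹) - t * (e r - e t * 1)) r := by
    intro r hr
    have hid := (hasDerivAt_id r).sub_const t
    exact ((hid.sub (((Real.hasDerivAt_log hr.ne').sub_const _).const_mul t)).const_mul _).sub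
      ((((hdiff2 r hr).hasDerivAt.sub_const _).sub (hid.const_mul _)).const_mul t)
  have hsign : ∀ r, 0 < r →
      0 ≤ (r - t) * ((K * t + C) * (1 - t * r⁻¹) - t * (e r - e t * 1)) := by
    intro r hr
    have hL : (r - t) * ((-t * e t) - (-r * e r)) ≤ K * (r - t) ^ 2 := by
      calc _ ≤ |r - t| * |(-t * e t) - (-r * e r)| := by
            rw [← abs_mul]; exact le_abs_self _
        _ ≤ |r - t| * (K * |r - t|) := by
            rw [abs_sub_comm (-t * e t)]
            exact mul_le_mul_of_nonneg_left (hlip r t hr ht) (abs_nonneg _)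
        _ = K * (r - t) ^ 2 := by rw [← sq_abs (r - t)]; ring
    have key : (r - t) * ((K * t + C) * (1 - t * r⁻¹) - t * (e r - e t * 1)) =
        (C - -t * e t) * (r - t) ^ 2 / r +
          t / r * (K * (r - t) ^ 2 - (r - t) * ((-t * e t) - (-r * e r))) := by
      field_simp
      ring
    rw [key]
    have hCt := sub_nonneg.2 (hbound t ht)
    have hLt := sub_nonneg.2 hL
    positivity
  have hmin := le_of_hasDerivAt_of_sub_mul_nonneg ht hθ hderiv hsign
  simp only [sub_self, mul_zero] at hmin
  exact sub_nonneg.1 hmin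
end
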